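/- Every ontology-mediated atomic query q = (O, A), where O is an LTL_krom^○ ontology and A an atomic concept, is FO(<,≡)-rewritable: there is a constant-free FO(<,≡)-formula q(t) with one free variable t such that ans(q, A) = {ℓ ∈ tem(A) : S_A ⊨ q(ℓ)} for every data instance A. -/

import Mathlib

namespace LTLOMQ

/-! ## Temporal concepts (LTL formulas) and their semantics over (ℤ,<) -/

/-- Temporal concepts: arbitrary LTL formulas over atomic concepts indexed by `ℕ`. -/
inductive TC : Type where
  | top : TC
  | atom : ℕ → TC
  | neg : TC → TC
  | and : TC → TC → TC
  | or : TC → TC → TC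
  | nextF : TC → TC
  | diamF : TC → TC
  | boxF : TC → TC
  | untl : TC → TC → TC
  | nextP : TC → TC
  | diamP : TC → TC
  | boxP : TC → TC
  | since : TC → TC → TC

/-- A temporal interpretation assigns to each atomic concept a subset of ℤ. -/
abbrev Itp : Type := ℕ → Set ℤ

/-- The extension of a temporal concept in an interpretation
(strict semantics over `(ℤ,<)`). -/
def TC.sem (M : Itp) : TC → Set ℤ
  | .top => Set.univ
  | .atom a => M a
  | .neg C => (TC.sem M C)ᶜ
  | .and C D => TC.sem M C ∩ TC.sem M D
  | .or C D => TC.sem M C ∪ TC.sem M D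
  | .nextF C => {n | n + 1 ∈ TC.sem M C}
  | .diamF C => {n | ∃ k, n < k ∧ k ∈ TC.sem M C}
  | .boxF C => {n | ∀ k, n < k → k ∈ TC.sem M C}
  | .untl C D => {n | ∃ k, n < k ∧ k ∈ TC.sem M D ∧ ∀ m, n < m → m < k → m ∈ TC.sem M C}
  | .nextP C => {n | n - 1 ∈ TC.sem M C}
  | .diamP C => {n | ∃ k, k < n ∧ k ∈ TC.sem M C}
  | .boxP C => {n | ∀ k, k < n → k ∈ TC.sem M C}
  | .since C D => {n | ∃ k, k < n ∧ k ∈ TC.sem M D ∧ ∀ m, k < m → m < n → m ∈ TC.sem M C}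

/-- Basic temporal concepts: built from atomic concepts using ○F, ○P, □F, □P. -/
inductive TC.IsBasic : TC → Prop
  | atom (a : ℕ) : TC.IsBasic (.atom a)
  | nextF {C : TC} : TC.IsBasic C → TC.IsBasic (.nextF C)
  | nextP {C : TC} : TC.IsBasic C → TC.IsBasic (.nextP C)
  | boxF {C : TC} : TC.IsBasic C → TC.IsBasic (.boxF C)
  | boxP {C : TC} : TC.IsBasic C → TC.IsBasic (.boxP C)

/-- Basic temporal concepts using □F and □P only. -/
inductive TC.IsBasicBox : TC → Prop
  | atom (a : ℕ) : TC.IsBasicBox (.atom a)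
  | boxF {C : TC} : TC.IsBasicBox C → TC.IsBasicBox (.boxF C)
  | boxP {C : TC} : TC.IsBasicBox C → TC.IsBasicBox (.boxP C)

/-- Basic temporal concepts using ○F and ○P only. -/
inductive TC.IsBasicNext : TC → Prop
  | atom (a : ℕ) : TC.IsBasicNext (.atom a)
  | nextF {C : TC} : TC.IsBasicNext C → TC.IsBasicNext (.nextF C)
  | nextP {C : TC} : TC.IsBasicNext C → TC.IsBasicNext (.nextP C)

/-- Positive temporal concepts: no occurrences of ¬. -/
inductive TC.IsPositive : TC → Prop
  | top : TC.IsPositive .top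
  | atom (a : ℕ) : TC.IsPositive (.atom a)
  | and {C D : TC} : TC.IsPositive C → TC.IsPositive D → TC.IsPositive (.and C D)
  | or {C D : TC} : TC.IsPositive C → TC.IsPositive D → TC.IsPositive (.or C D)
  | nextF {C : TC} : TC.IsPositive C → TC.IsPositive (.nextF C)
  | diamF {C : TC} : TC.IsPositive C → TC.IsPositive (.diamF C)
  | boxF {C : TC} : TC.IsPositive C → TC.IsPositive (.boxF C)
  | untl {C D : TC} : TC.IsPositive C → TC.IsPositive D → TC.IsPositive (.untl C D)
  | nextP {C : TC} : TC.IsPositive C → TC.IsPositive (.nextP C)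
  | diamP {C : TC} : TC.IsPositive C → TC.IsPositive (.diamP C)
  | boxP {C : TC} : TC.IsPositive C → TC.IsPositive (.boxP C)
  | since {C D : TC} : TC.IsPositive C → TC.IsPositive D → TC.IsPositive (.since C D)

/-- Prior-LTL formulas: Boolean connectives and □P, ◇P, □F, ◇F only. -/
inductive TC.IsPrior : TC → Prop
  | atom (a : ℕ) : TC.IsPrior (.atom a)
  | neg {C : TC} : TC.IsPrior C → TC.IsPrior (.neg C)
  | and {C D : TC} : TC.IsPrior C → TC.IsPrior D → TC.IsPrior (.and C D)
  | or {C D : TC} : TC.IsPrior C → TC.IsPrior D → TC.IsPrior (.or C D)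
  | boxF {C : TC} : TC.IsPrior C → TC.IsPrior (.boxF C)
  | boxP {C : TC} : TC.IsPrior C → TC.IsPrior (.boxP C)
  | diamF {C : TC} : TC.IsPrior C → TC.IsPrior (.diamF C)
  | diamP {C : TC} : TC.IsPrior C → TC.IsPrior (.diamP C)

/-- Number of occurrences of temporal operators in a temporal concept. -/
def TC.tempOps : TC → ℕ
  | .top => 0
  | .atom _ => 0
  | .neg C => TC.tempOps C
  | .and C D => TC.tempOps C + TC.tempOps D
  | .or C D => TC.tempOps C + TC.tempOps D
  | .nextF C => TC.tempOps C + 1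
  | .diamF C => TC.tempOps C + 1
  | .boxF C => TC.tempOps C + 1
  | .untl C D => TC.tempOps C + TC.tempOps D + 1
  | .nextP C => TC.tempOps C + 1
  | .diamP C => TC.tempOps C + 1
  | .boxP C => TC.tempOps C + 1
  | .since C D => TC.tempOps C + TC.tempOps D + 1

/-- Number of occurrences of symbols in a temporal concept. -/
def TC.size : TC → ℕ
  | .top => 1
  | .atom _ => 1
  | .neg C => TC.size C + 1
  | .and C D => TC.size C + TC.size D + 1
  | .or C D => TC.size C + TC.size D + 1
  | .nextF C => TC.size C + 1
  | .diamF C => TC.size C + 1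
  | .boxF C => TC.size C + 1
  | .untl C D => TC.size C + TC.size D + 1
  | .nextP C => TC.size C + 1
  | .diamP C => TC.size C + 1
  | .boxP C => TC.size C + 1
  | .since C D => TC.size C + TC.size D + 1

/-- The set of subconcepts of a temporal concept. -/
def TC.subs : TC → Set TC
  | .top => {.top}
  | .atom a => {.atom a}
  | .neg C => insert (.neg C) (TC.subs C)
  | .and C D => insert (.and C D) (TC.subs C ∪ TC.subs D)
  | .or C D => insert (.or C D) (TC.subs C ∪ TC.subs D)
  | .nextF C => insert (.nextF C) (TC.subs C)
  | .diamF C => insert (.diamF C) (TC.subs C)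
  | .boxF C => insert (.boxF C) (TC.subs C)
  | .untl C D => insert (.untl C D) (TC.subs C ∪ TC.subs D)
  | .nextP C => insert (.nextP C) (TC.subs C)
  | .diamP C => insert (.diamP C) (TC.subs C)
  | .boxP C => insert (.boxP C) (TC.subs C)
  | .since C D => insert (.since C D) (TC.subs C ∪ TC.subs D)

/-- The set of atomic concepts occurring in a temporal concept. -/
def TC.atoms : TC → Set ℕ
  | .top => ∅
  | .atom a => {a}
  | .neg C => TC.atoms C
  | .and C D => TC.atoms C ∪ TC.atoms D
  | .or C D => TC.atoms C ∪ TC.atoms D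
  | .nextF C => TC.atoms C
  | .diamF C => TC.atoms C
  | .boxF C => TC.atoms C
  | .untl C D => TC.atoms C ∪ TC.atoms D
  | .nextP C => TC.atoms C
  | .diamP C => TC.atoms C
  | .boxP C => TC.atoms C
  | .since C D => TC.atoms C ∪ TC.atoms D

/-! ## Clauses, ontologies, data instances -/

/-- A clause `C₁ ∧ … ∧ C_k → C_{k+1} ∨ … ∨ C_{k+m}`. -/
structure Clause : Type where
  prem : List TC
  concl : List TC

/-- A clause is true in `M` if the intersection of the extensions of the premises
is contained in the union of the extensions of the conclusions. -/
def Clause.holds (M : Itp) (cl : Clause) : Prop :=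
  ∀ n : ℤ, (∀ C ∈ cl.prem, n ∈ TC.sem M C) → ∃ C ∈ cl.concl, n ∈ TC.sem M C

/-- An ontology is a finite set (list) of clauses. -/
abbrev Ontology : Type := List Clause

def Clause.AllBasic (cl : Clause) : Prop :=
  (∀ C ∈ cl.prem, C.IsBasic) ∧ (∀ C ∈ cl.concl, C.IsBasic)

def Clause.AllBasicBox (cl : Clause) : Prop :=
  (∀ C ∈ cl.prem, C.IsBasicBox) ∧ (∀ C ∈ cl.concl, C.IsBasicBox)

def Clause.AllBasicNext (cl : Clause) : Prop :=
  (∀ C ∈ cl.prem, C.IsBasicNext) ∧ (∀ C ∈ cl.concl, C.IsBasicNext)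

/-- Horn: at most one disjunct in the conclusion. -/
def Clause.Horn (cl : Clause) : Prop := cl.concl.length ≤ 1

/-- Krom (binary): at most two concepts altogether. -/
def Clause.Krom (cl : Clause) : Prop := cl.prem.length + cl.concl.length ≤ 2

/-- LTL_bool^□○ ontologies. -/
def Ontology.BoolBoxNext (O : Ontology) : Prop := ∀ cl ∈ O, cl.AllBasic
/-- LTL_bool^□ ontologies. -/
def Ontology.BoolBox (O : Ontology) : Prop := ∀ cl ∈ O, cl.AllBasicBox
/-- LTL_krom^○ ontologies. -/
def Ontology.KromNext (O : Ontology) : Prop := ∀ cl ∈ O, cl.AllBasicNext ∧ cl.Krom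
/-- LTL_krom^□○ ontologies. -/
def Ontology.KromBoxNext (O : Ontology) : Prop := ∀ cl ∈ O, cl.AllBasic ∧ cl.Krom
/-- LTL_horn^□○ ontologies. -/
def Ontology.HornBoxNext (O : Ontology) : Prop := ∀ cl ∈ O, cl.AllBasic ∧ cl.Horn
/-- LTL_horn^□ ontologies. -/
def Ontology.HornBox (O : Ontology) : Prop := ∀ cl ∈ O, cl.AllBasicBox ∧ cl.Horn
/-- LTL_core^□○ ontologies. -/
def Ontology.CoreBoxNext (O : Ontology) : Prop := ∀ cl ∈ O, cl.AllBasic ∧ cl.Horn ∧ cl.Krom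

/-- Number of occurrences of symbols in a clause. -/
def Clause.size (cl : Clause) : ℕ :=
  (cl.prem.map TC.size).sum + (cl.concl.map TC.size).sum + 1

/-- Number of occurrences of symbols in an ontology. -/
def Ontology.size (O : Ontology) : ℕ := (O.map Clause.size).sum

/-- The atomic concept `a` occurs in the ontology `O`. -/
def Ontology.occurs (O : Ontology) (a : ℕ) : Prop :=
  ∃ cl ∈ O, (∃ C ∈ cl.prem, a ∈ C.atoms) ∨ (∃ C ∈ cl.concl, a ∈ C.atoms)

/-- The set of subconcepts of (concepts occurring in) an ontology. -/
def Ontology.subs (O : Ontology) : Set TC :=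
  {C | ∃ cl ∈ O, ∃ D : TC, (D ∈ cl.prem ∨ D ∈ cl.concl) ∧ C ∈ D.subs}

/-- A flat concept: an atomic concept, or a single ○F or ○P applied to an atomic concept. -/
def TC.IsFlat : TC → Prop
  | .atom _ => True
  | .nextF (.atom _) => True
  | .nextP (.atom _) => True
  | _ => False

/-- An ontology without nested temporal operators. -/
def Ontology.Flat (O : Ontology) : Prop :=
  ∀ cl ∈ O, (∀ C ∈ cl.prem, C.IsFlat) ∧ (∀ C ∈ cl.concl, C.IsFlat)

/-- A data instance: a finite nonempty set of timestamped atoms, normalized so that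
the minimal timestamp is 0 and the maximal one is ≥ 1. -/
structure DataInstance : Type where
  atoms : Finset (ℕ × ℤ)
  nonneg : ∀ p ∈ atoms, 0 ≤ p.2
  has_zero : ∃ p ∈ atoms, p.2 = 0
  has_one : ∃ p ∈ atoms, 1 ≤ p.2

theorem DataInstance.ts_nonempty (A : DataInstance) :
    (A.atoms.image Prod.snd).Nonempty := by
  obtain ⟨p, hp, -⟩ := A.has_zero
  exact ⟨p.2, Finset.mem_image_of_mem _ hp⟩

/-- min A: the minimal timestamp occurring in the data instance (equal to 0). -/
def DataInstance.minT (A : DataInstance) : ℤ :=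
  (A.atoms.image Prod.snd).min' A.ts_nonempty

/-- max A: the maximal timestamp occurring in the data instance. -/
def DataInstance.maxT (A : DataInstance) : ℤ :=
  (A.atoms.image Prod.snd).max' A.ts_nonempty

/-- The active temporal domain tem(A). -/
def DataInstance.tem (A : DataInstance) : Set ℤ := Set.Icc A.minT A.maxT

/-- The interpretation of atomic concepts in the first-order structure S_A. -/
def DataInstance.itp (A : DataInstance) : Itp := fun a => {n | (a, n) ∈ A.atoms}

/-- `M` is a model of the knowledge base `(O, A)`. -/
def IsModel (M : Itp) (O : Ontology) (A : DataInstance) : Prop :=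
  (∀ cl ∈ O, cl.holds M) ∧ ∀ p ∈ A.atoms, p.2 ∈ M p.1

/-- The ontology `O` is consistent. -/
def Ontology.Consistent (O : Ontology) : Prop := ∃ M : Itp, ∀ cl ∈ O, cl.holds M

/-- The data instance `A` is consistent with `O`. -/
def ConsistentWith (O : Ontology) (A : DataInstance) : Prop := ∃ M : Itp, IsModel M O A

/-- Certain answers to the OMIQ `(O, κ)` over `A` (within the active domain). -/
def certAns (O : Ontology) (κ : TC) (A : DataInstance) : Set ℤ :=
  {ℓ | ℓ ∈ A.tem ∧ ∀ M : Itp, IsModel M O A → ℓ ∈ TC.sem M κ}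

/-- Certain answers to the OMIQ `(O, κ)` over `A` and ℤ. -/
def certAnsZ (O : Ontology) (κ : TC) (A : DataInstance) : Set ℤ :=
  {ℓ | ∀ M : Itp, IsModel M O A → ℓ ∈ TC.sem M κ}

/-! ## First-order, MSO and FO(RPR) formulas over the temporal structures -/

/-- Formulas of the target languages: first-order variables are indexed by `ℕ`,
as are second-order (set) variables and the recursively defined relation variables
of FO(RPR).  The constructors `qprev j` and `qapp j x` stand for `Q_j(t-1)` (inside
a recursive definition block) and `Q_j(x)`, respectively; `rpr n Θ tv ψ` is the
relational-primitive-recursion construct `[Q₁(t) ≡ Θ₁; …; Q_n(t) ≡ Θ_n] ψ`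
with recursion variable `tv`. -/
inductive Fml : Type where
  | falsum : Fml
  | atom : ℕ → ℕ → Fml        -- A(x)
  | lt : ℕ → ℕ → Fml          -- x < y
  | eq : ℕ → ℕ → Fml          -- x = y
  | succ : ℕ → ℕ → Fml        -- x = y + 1
  | mod : ℕ → ℕ → Fml         -- x ≡ 0 (mod n)
  | svar : ℕ → ℕ → Fml        -- X(x), X a set variable
  | qprev : ℕ → Fml           -- Q_j(t−1)
  | qapp : ℕ → ℕ → Fml        -- Q_j(x)
  | neg : Fml → Fml
  | and : Fml → Fml → Fml
  | or : Fml → Fml → Fml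
  | ex : ℕ → Fml → Fml
  | all : ℕ → Fml → Fml
  | exS : ℕ → Fml → Fml       -- second-order ∃
  | allS : ℕ → Fml → Fml      -- second-order ∀
  | rpr : (n : ℕ) → (Fin n → Fml) → ℕ → Fml → Fml

/-- Evaluation of a formula over the structure with (active) domain `D ⊆ ℤ`
and interpretation `I` of the unary predicates; `env` assigns first-order
variables, `senv` set variables, `prev` the placeholders `Q_j(t-1)` and
`Q` the defined relation variables. First-order quantifiers range over `D`,
second-order quantifiers over subsets of `D`. -/
def Fml.eval (D : Set ℤ) (I : ℕ → Set ℤ) :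
    Fml → (ℕ → ℤ) → (ℕ → Set ℤ) → (ℕ → Prop) → (ℕ → ℤ → Prop) → Prop
  | .falsum, _, _, _, _ => False
  | .atom a x, env, _, _, _ => env x ∈ I a
  | .lt x y, env, _, _, _ => env x < env y
  | .eq x y, env, _, _, _ => env x = env y
  | .succ x y, env, _, _, _ => env x = env y + 1
  | .mod n x, env, _, _, _ => (n : ℤ) ∣ env x
  | .svar X x, env, senv, _, _ => env x ∈ senv X
  | .qprev j, _, _, prev, _ => prev j
  | .qapp j x, env, _, _, Q => Q j (env x)
  | .neg φ, env, senv, prev, Q => ¬ Fml.eval D I φ env senv prev Q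
  | .and φ ψ, env, senv, prev, Q =>
      Fml.eval D I φ env senv prev Q ∧ Fml.eval D I ψ env senv prev Q
  | .or φ ψ, env, senv, prev, Q =>
      Fml.eval D I φ env senv prev Q ∨ Fml.eval D I ψ env senv prev Q
  | .ex x φ, env, senv, prev, Q =>
      ∃ d ∈ D, Fml.eval D I φ (Function.update env x d) senv prev Q
  | .all x φ, env, senv, prev, Q =>
      ∀ d ∈ D, Fml.eval D I φ (Function.update env x d) senv prev Q
  | .exS X φ, env, senv, prev, Q =>
      ∃ S : Set ℤ, S ⊆ D ∧ Fml.eval D I φ env (Function.update senv X S) prev Q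
  | .allS X φ, env, senv, prev, Q =>
      ∀ S : Set ℤ, S ⊆ D → Fml.eval D I φ env (Function.update senv X S) prev Q
  | .rpr n Θ tv ψ, env, senv, prev, Q =>
      -- the semantics of each Θ_j, as a function of the first-order environment
      -- and of the truth values of the `Q_j(t−1)` placeholders
      let f : Fin n → (ℕ → ℤ) → (ℕ → Prop) → Prop :=
        fun j env' prev' => Fml.eval D I (Θ j) env' senv prev' Q
      -- the recursively computed truth values of `Q_j` at time `k` (recursion on k from 0)
      let recQ : ℕ → Fin n → Prop := fun k =>
        Nat.rec (fun j => f j (Function.update env tv 0) (fun _ => False))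
          (fun m ih j => f j (Function.update env tv ((m : ℤ) + 1))
            (fun i => ∃ h : i < n, ih ⟨i, h⟩)) k
      Fml.eval D I ψ env senv prev
        (fun j z => ∃ h : j < n, 0 ≤ z ∧ recQ z.toNat ⟨j, h⟩)

/-- Free first-order variables of a formula. -/
def Fml.fvars : Fml → Set ℕ
  | .falsum => ∅
  | .atom _ x => {x}
  | .lt x y => {x, y}
  | .eq x y => {x, y}
  | .succ x y => {x, y}
  | .mod _ x => {x}
  | .svar _ x => {x}
  | .qprev _ => ∅
  | .qapp _ x => {x}
  | .neg φ => Fml.fvars φ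
  | .and φ ψ => Fml.fvars φ ∪ Fml.fvars ψ
  | .or φ ψ => Fml.fvars φ ∪ Fml.fvars ψ
  | .ex x φ => Fml.fvars φ \ {x}
  | .all x φ => Fml.fvars φ \ {x}
  | .exS _ φ => Fml.fvars φ
  | .allS _ φ => Fml.fvars φ
  | .rpr n Θ tv ψ => (⋃ j : Fin n, Fml.fvars (Θ j) \ {tv}) ∪ Fml.fvars ψ

/-- FO(<)-formulas: first-order logic with the built-in linear order
(and the definable equality predicate); no constants, no arithmetic. -/
def Fml.IsFOlt : Fml → Prop
  | .falsum => True
  | .atom _ _ => True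
  | .lt _ _ => True
  | .eq _ _ => True
  | .neg φ => Fml.IsFOlt φ
  | .and φ ψ => Fml.IsFOlt φ ∧ Fml.IsFOlt ψ
  | .or φ ψ => Fml.IsFOlt φ ∧ Fml.IsFOlt ψ
  | .ex _ φ => Fml.IsFOlt φ
  | .all _ φ => Fml.IsFOlt φ
  | _ => False

/-- FO(<,≡)-formulas: FO(<) extended with the predicates `t ≡ 0 (mod n)`, `n > 1`. -/
def Fml.IsFOltMod : Fml → Prop
  | .falsum => True
  | .atom _ _ => True
  | .lt _ _ => True
  | .eq _ _ => True
  | .mod n _ => 2 ≤ n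
  | .neg φ => Fml.IsFOltMod φ
  | .and φ ψ => Fml.IsFOltMod φ ∧ Fml.IsFOltMod ψ
  | .or φ ψ => Fml.IsFOltMod φ ∧ Fml.IsFOltMod ψ
  | .ex _ φ => Fml.IsFOltMod φ
  | .all _ φ => Fml.IsFOltMod φ
  | _ => False

/-- MSO(<)-formulas: FO(<) extended with set variables and second-order quantifiers. -/
def Fml.IsMSO : Fml → Prop
  | .falsum => True
  | .atom _ _ => True
  | .lt _ _ => True
  | .eq _ _ => True
  | .svar _ _ => True
  | .neg φ => Fml.IsMSO φ
  | .and φ ψ => Fml.IsMSO φ ∧ Fml.IsMSO ψ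
  | .or φ ψ => Fml.IsMSO φ ∧ Fml.IsMSO ψ
  | .ex _ φ => Fml.IsMSO φ
  | .all _ φ => Fml.IsMSO φ
  | .exS _ φ => Fml.IsMSO φ
  | .allS _ φ => Fml.IsMSO φ
  | _ => False

/-- FO(RPR)-formulas: FO(<) extended with successor and relational primitive recursion. -/
def Fml.IsRPR : Fml → Prop
  | .falsum => True
  | .atom _ _ => True
  | .lt _ _ => True
  | .eq _ _ => True
  | .succ _ _ => True
  | .qprev _ => True
  | .qapp _ _ => True
  | .neg φ => Fml.IsRPR φ
  | .and φ ψ => Fml.IsRPR φ ∧ Fml.IsRPR ψ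
  | .or φ ψ => Fml.IsRPR φ ∧ Fml.IsRPR ψ
  | .ex _ φ => Fml.IsRPR φ
  | .all _ φ => Fml.IsRPR φ
  | .rpr n Θ _ ψ => (∀ j : Fin n, Fml.IsRPR (Θ j)) ∧ Fml.IsRPR ψ
  | _ => False

/-- MFO(<)-formulas: monadic first-order formulas built from atoms `A(t)`,
`t < t'`, `t = t'` and `t = t' + 1`. -/
def Fml.IsMFO : Fml → Prop
  | .falsum => True
  | .atom _ _ => True
  | .lt _ _ => True
  | .eq _ _ => True
  | .succ _ _ => True
  | .neg φ => Fml.IsMFO φ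
  | .and φ ψ => Fml.IsMFO φ ∧ Fml.IsMFO ψ
  | .or φ ψ => Fml.IsMFO φ ∧ Fml.IsMFO ψ
  | .ex _ φ => Fml.IsMFO φ
  | .all _ φ => Fml.IsMFO φ
  | _ => False

/-- Quasi-positive MFO(<)-formulas: built from atoms `A(t)`, `t < t'`, `t = t'`,
`t = t' + 1` (and ⊥) using ∧, ∨, ∃, ∀ as well as guarded universal quantification
`∀y (x < y < z → φ)`, `∀y (x < y → φ)`, `∀y (y < z → φ)`
(the guarded implications are encoded via `¬guard ∨ φ`). -/
inductive Fml.IsQP : Fml → Prop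
  | falsum : Fml.IsQP .falsum
  | atom (a x : ℕ) : Fml.IsQP (.atom a x)
  | lt (x y : ℕ) : Fml.IsQP (.lt x y)
  | eq (x y : ℕ) : Fml.IsQP (.eq x y)
  | succ (x y : ℕ) : Fml.IsQP (.succ x y)
  | and {φ ψ : Fml} : Fml.IsQP φ → Fml.IsQP ψ → Fml.IsQP (.and φ ψ)
  | or {φ ψ : Fml} : Fml.IsQP φ → Fml.IsQP ψ → Fml.IsQP (.or φ ψ)
  | ex (x : ℕ) {φ : Fml} : Fml.IsQP φ → Fml.IsQP (.ex x φ)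
  | all (x : ℕ) {φ : Fml} : Fml.IsQP φ → Fml.IsQP (.all x φ)
  | allBtw (y x z : ℕ) {φ : Fml} : Fml.IsQP φ →
      Fml.IsQP (.all y (.or (.neg (.and (.lt x y) (.lt y z))) φ))
  | allGt (y x : ℕ) {φ : Fml} : Fml.IsQP φ →
      Fml.IsQP (.all y (.or (.neg (.lt x y)) φ))
  | allLt (y z : ℕ) {φ : Fml} : Fml.IsQP φ →
      Fml.IsQP (.all y (.or (.neg (.lt y z)) φ))

/-- Evaluation in a structure with domain `D` and unary predicates `I`
(no set variables, placeholders or relation variables supplied). -/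
def Fml.evalIn (D : Set ℤ) (I : Itp) (φ : Fml) (env : ℕ → ℤ) : Prop :=
  Fml.eval D I φ env (fun _ => ∅) (fun _ => False) (fun _ _ => False)

/-- An MFO(<)-formula is monotone if it is preserved under adding time points
to the extensions of the atomic concepts. -/
def MonotoneFml (ψ : Fml) : Prop :=
  ∀ M₁ M₂ : Itp, (∀ a : ℕ, M₁ a ⊆ M₂ a) → ∀ env : ℕ → ℤ,
    Fml.evalIn Set.univ M₁ ψ env → Fml.evalIn Set.univ M₂ ψ env

/-! ## The canonical model of a Horn ontology and a data instance -/

/-- Atoms of the closure: ⊥ or `C(n)` for a (basic) temporal concept `C` and `n ∈ ℤ`. -/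
inductive EAtom : Type where
  | bot : EAtom
  | conc : TC → ℤ → EAtom

/-- One (non-recursive) application of the closure rules of the canonical model. -/
def clStep (O : Ontology) (Λ : Set EAtom) : Set EAtom :=
  Λ ∪
  {e | ∃ cl ∈ O, ∃ n : ℤ, (∀ C ∈ cl.prem, EAtom.conc C n ∈ Λ) ∧
        ((∃ C : TC, cl.concl = [C] ∧ e = EAtom.conc C n) ∨
          (cl.concl = [] ∧ e = EAtom.bot))} ∪
  {e | ∃ C : TC, ∃ n k : ℤ, n < k ∧ EAtom.conc (.boxF C) n ∈ Λ ∧ e = EAtom.conc C k} ∪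
  {e | ∃ C : TC, ∃ n : ℤ, (∀ k : ℤ, n < k → EAtom.conc C k ∈ Λ) ∧
        e = EAtom.conc (.boxF C) n} ∪
  {e | ∃ C : TC, ∃ n : ℤ, EAtom.conc (.nextF C) n ∈ Λ ∧ e = EAtom.conc C (n + 1)} ∪
  {e | ∃ C : TC, ∃ n : ℤ, EAtom.conc C (n + 1) ∈ Λ ∧ e = EAtom.conc (.nextF C) n} ∪
  {e | ∃ C : TC, ∃ n k : ℤ, k < n ∧ EAtom.conc (.boxP C) n ∈ Λ ∧ e = EAtom.conc C k} ∪
  {e | ∃ C : TC, ∃ n : ℤ, (∀ k : ℤ, k < n → EAtom.conc C k ∈ Λ) ∧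
        e = EAtom.conc (.boxP C) n} ∪
  {e | ∃ C : TC, ∃ n : ℤ, EAtom.conc (.nextP C) n ∈ Λ ∧ e = EAtom.conc C (n - 1)} ∪
  {e | ∃ C : TC, ∃ n : ℤ, EAtom.conc C (n - 1) ∈ Λ ∧ e = EAtom.conc (.nextP C) n}

/-- Transfinite iteration of the closure rules. -/
noncomputable def clIter (O : Ontology) (Λ : Set EAtom) (o : Ordinal.{0}) : Set EAtom :=
  Ordinal.limitRecOn o Λ (fun _ ih => clStep O ih)
    (fun o _ ih => ⋃ (o' : Ordinal.{0}), ⋃ (h : o' < o), ih o' h)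

/-- The atoms of a data instance, as a set of closure atoms. -/
def dataAtoms (A : DataInstance) : Set EAtom :=
  {e | ∃ p ∈ A.atoms, e = EAtom.conc (.atom p.1) p.2}

open Ordinal in
/-- The canonical model `C_{O,A}`: the closure of `A` under the rules,
iterated up to the first uncountable ordinal ω₁. -/
noncomputable def canon (O : Ontology) (A : DataInstance) : Set EAtom :=
  clIter O (dataAtoms A) (Ordinal.omega 1)

/-- The canonical model regarded as a temporal interpretation. -/
noncomputable def canonItp (O : Ontology) (A : DataInstance) : Itp :=
  fun a => {n | EAtom.conc (.atom a) n ∈ canon O A}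

/-- The type `τ_{O,A}(n)`: the set of subconcepts of `O` that hold at `n`
in the canonical model. -/
noncomputable def tau (O : Ontology) (A : DataInstance) (n : ℤ) : Set TC :=
  {C ∈ O.subs | n ∈ TC.sem (canonItp O A) C}

/-! ## Literals and the reachability relation ⇝ for Krom ontologies -/

/-- A simple literal: an atomic concept with a polarity. -/
abbrev Lit : Type := ℕ × Bool

/-- The temporal concept corresponding to a literal. -/
def Lit.toTC (L : Lit) : TC := if L.2 then .atom L.1 else .neg (.atom L.1)

def TC.iterF : ℕ → TC → TC
  | 0, C => C
  | k + 1, C => .nextF (TC.iterF k C)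

def TC.iterP : ℕ → TC → TC
  | 0, C => C
  | k + 1, C => .nextP (TC.iterP k C)

/-- `○^k C`: `k` occurrences of ○F if `k > 0`, of ○P if `k < 0`. -/
def TC.shift (k : ℤ) (C : TC) : TC :=
  if 0 ≤ k then TC.iterF k.toNat C else TC.iterP (-k).toNat C

/-- `(L₁,n₁) ⇝ (L₂,n₂)`: in every model of `O`,
`(○^{n₁} L₁)^M ⊆ (○^{n₂} L₂)^M`. -/
def leadsTo (O : Ontology) (L₁ : Lit) (n₁ : ℤ) (L₂ : Lit) (n₂ : ℤ) : Prop :=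
  ∀ M : Itp, (∀ cl ∈ O, cl.holds M) →
    TC.sem M (TC.shift n₁ L₁.toTC) ⊆ TC.sem M (TC.shift n₂ L₂.toTC)


/-! ## Walks in integer-weighted graphs -/

/-- `Walk E V i w j`: there is a nonempty walk from `i` to `j` of total weight `w` along
the weighted edges `E` whose intermediate vertices all belong to `V`. -/
inductive Walk {α : Type*} (E : α → ℤ → α → Prop) (V : Set α) (i : α) : ℤ → α → Prop
  | edge {w : ℤ} {j : α} : E i w j → Walk E V i w j
  | step {w w' : ℤ} {v j : α} : Walk E V i w v → v ∈ V → E v w' j → Walk E V i (w + w') j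

namespace Walk

open scoped Pointwise

variable {α : Type*} {E : α → ℤ → α → Prop} {V W : Set α}

theorem mono (h : V ⊆ W) {i j : α} {w : ℤ} (hw : Walk E V i w j) : Walk E W i w j := by
  induction hw with
  | edge he => exact .edge he
  | step _ hv he ih => exact .step ih (h hv) he

theorem append {i v j : α} {w w' : ℤ} (h : Walk E V i w v) (hv : v ∈ V)
    (h' : Walk E V v w' j) : Walk E V i (w + w') j := by
  induction h' with
  | edge he => exact .step h hv he
  | step _ hu he ih => rw [← add_assoc]; exact .step ih hu he

theorem append_closure {i v : α} {w c : ℤ} (hv : v ∈ V) (h : Walk E V i w v)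
    (hc : c ∈ AddSubmonoid.closure {c | Walk E V v c v}) : Walk E V i (w + c) v := by
  induction hc using AddSubmonoid.closure_induction generalizing w with
  | mem c hc => exact h.append hv hc
  | zero => simpa using h
  | add x y _ _ hx hy => rw [← add_assoc]; exact hy (hx h)

theorem setOf_insert (v i j : α) :
    {w | Walk E (insert v V) i w j} = {w | Walk E V i w j} ∪
      ({w | Walk E V i w v} + (AddSubmonoid.closure {w | Walk E V v w v} : Set ℤ) +
        {w | Walk E V v w j}) := by
  have hV : V ⊆ insert v V := Set.subset_insert v V
  have hv : v ∈ insert v V := Set.mem_insert v V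
  apply Set.Subset.antisymm
  · intro w hw
    simp only [Set.mem_ofPred_eq] at hw
    induction hw with
    | edge he => exact Or.inl (.edge he)
    | @step w w' u j _ hu he ih =>
      rcases ih with h | ⟨_, ⟨x, hx, c, hc, rfl⟩, y, hy, rfl⟩
      · rcases hu with rfl | hu
        · exact Or.inr ⟨w, ⟨w, h, 0, zero_mem _, by simp⟩, w', .edge he, rfl⟩
        · exact Or.inl (Walk.step h hu he)
      · right
        rcases hu with rfl | hu
        · exact ⟨x + (c + y), ⟨x, hx, c + y, add_mem hc (AddSubmonoid.subset_closure hy), rfl⟩,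
            w', .edge he, by simp only; ring⟩
        · exact ⟨x + c, ⟨x, hx, c, hc, rfl⟩, y + w', Walk.step hy hu he, by simp only; ring⟩
  · rintro w (h | ⟨_, ⟨x, hx, c, hc, rfl⟩, y, hy, rfl⟩)
    · exact mono hV h
    · refine append (append_closure hv (mono hV hx) ?_) hv (mono hV hy)
      exact AddSubmonoid.closure_mono (fun _ => mono hV) hc

theorem isSemilinearSet (hV : V.Finite) (hE : ∀ i j, {w | E i w j}.Finite) (i j : α) :
    IsSemilinearSet {w | Walk E V i w j} := by
  induction V, hV using Set.Finite.induction_on generalizing i j with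
  | empty =>
    convert IsSemilinearSet.of_finite (hE i j) using 1
    ext w
    constructor
    · rintro (h | ⟨_, h, _⟩)
      · exact h
      · exact h.elim
    · exact .edge
  | insert _ _ ih =>
    rw [setOf_insert]
    exact (ih i j).union (((ih _ _).add (ih _ _).closure).add (ih _ j))

end Walk

/-! ## Definability in FO(<,≡) over data instances -/

/-- The relation `R` is defined by an FO(<,≡)-formula with free variables in `F`, uniformly
over all domains `[0, T]`. -/
def Dfn (F : Set ℕ) (R : ℤ → Itp → (ℕ → ℤ) → Prop) : Prop :=
  ∃ φ : Fml, φ.IsFOltMod ∧ φ.fvars ⊆ F ∧ ∀ (T : ℤ) (I : Itp) (env : ℕ → ℤ), 0 ≤ T →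
    (∀ x, env x ∈ Set.Icc 0 T) → (φ.evalIn (Set.Icc 0 T) I env ↔ R T I env)

namespace Dfn

variable {F G : Set ℕ} {R S : ℤ → Itp → (ℕ → ℤ) → Prop}

theorem congr (h : Dfn F R) (hRS : ∀ (T : ℤ) (I : Itp) (env : ℕ → ℤ), 0 ≤ T →
    (∀ x, env x ∈ Set.Icc 0 T) → (R T I env ↔ S T I env)) : Dfn F S := by
  obtain ⟨φ, h1, h2, h3⟩ := h
  exact ⟨φ, h1, h2, fun T I env hT he => (h3 T I env hT he).trans (hRS T I env hT he)⟩

theorem mono (h : Dfn F R) (hFG : F ⊆ G) : Dfn G R := by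
  obtain ⟨φ, h1, h2, h3⟩ := h
  exact ⟨φ, h1, h2.trans hFG, h3⟩

theorem not (h : Dfn F R) : Dfn F fun T I env => ¬ R T I env := by
  obtain ⟨φ, h1, h2, h3⟩ := h
  exact ⟨.neg φ, h1, h2, fun T I env hT he => not_congr (h3 T I env hT he)⟩

theorem and (h : Dfn F R) (h' : Dfn F S) : Dfn F fun T I env => R T I env ∧ S T I env := by
  obtain ⟨φ, h1, h2, h3⟩ := h
  obtain ⟨ψ, h1', h2', h3'⟩ := h'
  exact ⟨.and φ ψ, ⟨h1, h1'⟩, Set.union_subset h2 h2',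
    fun T I env hT he => and_congr (h3 T I env hT he) (h3' T I env hT he)⟩

theorem or (h : Dfn F R) (h' : Dfn F S) : Dfn F fun T I env => R T I env ∨ S T I env := by
  obtain ⟨φ, h1, h2, h3⟩ := h
  obtain ⟨ψ, h1', h2', h3'⟩ := h'
  exact ⟨.or φ ψ, ⟨h1, h1'⟩, Set.union_subset h2 h2',
    fun T I env hT he => or_congr (h3 T I env hT he) (h3' T I env hT he)⟩

theorem const (P : Prop) : Dfn F fun _ _ _ => P := by
  by_cases hP : P
  · exact ⟨.neg .falsum, trivial, Set.empty_subset _, fun T I env _ _ => by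
      simp [Fml.evalIn, Fml.eval, hP]⟩
  · exact ⟨.falsum, trivial, Set.empty_subset _, fun T I env _ _ => by
      simp [Fml.evalIn, Fml.eval, hP]⟩

theorem exists_mem {ι : Type*} {s : Set ι} (hs : s.Finite)
    {R : ι → ℤ → Itp → (ℕ → ℤ) → Prop} (h : ∀ i ∈ s, Dfn F (R i)) :
    Dfn F fun T I env => ∃ i ∈ s, R i T I env := by
  induction s, hs using Set.Finite.induction_on with
  | empty => exact (const False).congr (by simp)
  | @insert i s _ _ ih =>
    refine ((h i (Set.mem_insert i s)).or
      (ih fun j hj => h j (Set.mem_insert_of_mem i hj))).congr fun T I env _ _ => ?_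
    simp

theorem ex (x : ℕ) (h : Dfn F R) :
    Dfn (F \ {x}) fun T I env => ∃ d ∈ Set.Icc 0 T, R T I (Function.update env x d) := by
  obtain ⟨φ, h1, h2, h3⟩ := h
  refine ⟨.ex x φ, h1, Set.sdiff_subset_sdiff_left h2, fun T I env hT he => ?_⟩
  refine exists_congr fun d => and_congr_right fun hd => h3 T I _ hT fun y => ?_
  by_cases hy : y = x
  · simpa [hy] using hd
  · simpa [hy] using he y

theorem atom (b x : ℕ) : Dfn {x} fun _ I env => env x ∈ I b :=
  ⟨.atom b x, trivial, subset_rfl, fun _ _ _ _ _ => Iff.rfl⟩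

theorem lt (x y : ℕ) : Dfn {x, y} fun _ _ env => env x < env y :=
  ⟨.lt x y, trivial, subset_rfl, fun _ _ _ _ _ => Iff.rfl⟩

theorem dvd {p : ℕ} (hp : 2 ≤ p) (x : ℕ) : Dfn {x} fun _ _ env => (p : ℤ) ∣ env x :=
  ⟨.mod p x, hp, subset_rfl, fun _ _ _ _ _ => Iff.rfl⟩

theorem add_natCast_le (k x y : ℕ) : Dfn {x, y} fun _ _ env => env x + k ≤ env y := by
  induction k generalizing x y with
  | zero => exact ((lt y x).not.mono (Set.pair_comm y x).subset).congr (by simp)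
  | succ k ih =>
    have hx : x ≠ x + y + 1 := by omega
    have hy : y ≠ x + y + 1 := by omega
    have h := (((lt x (x + y + 1)).mono (G := {x, y, x + y + 1}) (by grind)).and
      ((ih (x + y + 1) y).mono (by grind))).ex (x + y + 1)
    refine (h.mono (by grind)).congr fun T I env hT he => ?_
    simp only [Function.update_self, Function.update_of_ne hx, Function.update_of_ne hy,
      Set.mem_Icc]
    have h1 := he x
    have h2 := he y
    simp only [Set.mem_Icc] at h1 h2
    constructor
    · rintro ⟨d, hd, h3, h4⟩
      push_cast
      linarith
    · intro h3
      push_cast at h3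
      exact ⟨env x + 1, ⟨by linarith, by linarith⟩, by linarith, by linarith⟩

theorem emod_eq {p : ℕ} (hp : 2 ≤ p) (r x : ℕ) (hr : r < p) :
    Dfn {x} fun _ _ env => env x % p = r := by
  have hx : x ≠ x + 1 := by omega
  have h := (((((add_natCast_le r (x + 1) x).and
    ((add_natCast_le (r + 1) (x + 1) x).not))).mono (G := {x, x + 1}) (by grind)).and
      ((dvd hp (x + 1)).mono (by grind))).ex (x + 1)
  refine (h.mono (by grind)).congr fun T I env hT he => ?_
  simp only [Function.update_self, Function.update_of_ne hx, Set.mem_Icc]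
  have h1 := he x
  simp only [Set.mem_Icc] at h1
  constructor
  · rintro ⟨d, hd, ⟨h3, h4⟩, c, rfl⟩
    push_cast at h4
    have : env x = r + p * c := by linarith
    rw [this, Int.add_mul_emod_self_left]
    exact Int.emod_eq_of_lt (by positivity) (by exact_mod_cast hr)
  · intro h3
    have h4 := Int.emod_add_mul_ediv (env x) p
    have h5 : 0 ≤ (p : ℤ) * (env x / p) :=
      mul_nonneg (by positivity) (Int.ediv_nonneg h1.1 (by positivity))
    refine ⟨p * (env x / p), ⟨h5, ?_⟩, ⟨?_, ?_⟩, dvd_mul_right _ _⟩ <;> push_cast <;> linarith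

end Dfn

/-- The relation `y - x ∈ D` is FO(<,≡)-definable. -/
def DiffDfn (D : Set ℤ) : Prop := ∀ x y : ℕ, Dfn {x, y} fun _ _ env => env y - env x ∈ D

namespace DiffDfn

open scoped Pointwise

variable {D : Set ℤ}

theorem sUnion {𝒟 : Set (Set ℤ)} (h𝒟 : 𝒟.Finite) (h : ∀ D ∈ 𝒟, DiffDfn D) :
    DiffDfn (⋃₀ 𝒟) :=
  fun x y => (Dfn.exists_mem h𝒟 fun D hD => h D hD x y).congr (by simp)

theorem neg (h : DiffDfn (-D)) : DiffDfn D :=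
  fun x y => ((h y x).mono (Set.pair_comm y x).subset).congr (by simp)

theorem inter {D' : Set ℤ} (h : DiffDfn D) (h' : DiffDfn D') : DiffDfn (D ∩ D') :=
  fun x y => (h x y).and (h' x y)

theorem Ici (m : ℤ) : DiffDfn (Set.Ici m) := by
  intro x y
  rcases le_total 0 m with hm | hm
  · lift m to ℕ using hm
    refine (Dfn.add_natCast_le m x y).congr fun T I env _ _ => ?_
    simp only [Set.mem_Ici]
    constructor <;> intro h <;> linarith
  · obtain ⟨k, rfl⟩ : ∃ k : ℕ, m = -k := ⟨(-m).toNat, by omega⟩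
    refine ((Dfn.add_natCast_le (k + 1) y x).not.mono (Set.pair_comm y x).subset).congr
      fun T I env _ _ => ?_
    simp only [Set.mem_Ici]
    push_cast
    constructor <;> intro h <;> omega

theorem singleton (m : ℤ) : DiffDfn {m} := by
  intro x y
  refine ((Ici m x y).and (Ici (m + 1) x y).not).congr fun T I env _ _ => ?_
  simp only [Set.mem_Ici, Set.mem_singleton_iff]
  omega

theorem emod_eq {p : ℕ} (hp : 2 ≤ p) (r : ℤ) : DiffDfn {d | d % p = r} := by
  intro x y
  have h : Dfn {x, y} fun _ _ env => ∃ s ∈ {s : ℕ × ℕ | s.1 < p ∧ s.2 < p ∧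
      ((s.2 : ℤ) - s.1) % p = r}, env x % p = s.1 ∧ env y % p = s.2 := by
    refine Dfn.exists_mem (((Set.finite_Iio p).prod (Set.finite_Iio p)).subset ?_) ?_
    · rintro s ⟨h1, h2, -⟩
      exact ⟨h1, h2⟩
    · rintro s ⟨h1, h2, -⟩
      exact ((Dfn.emod_eq hp s.1 x h1).mono (by simp)).and
        ((Dfn.emod_eq hp s.2 y h2).mono (by simp))
  refine h.congr fun T I env _ _ => ?_
  have hp0 : (0 : ℤ) < p := by omega
  constructor
  · rintro ⟨s, ⟨-, -, h⟩, h1, h2⟩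
    rw [Set.mem_ofPred_eq, Int.sub_emod, h1, h2, h]
  · intro h
    have hx := Int.emod_nonneg (env x) hp0.ne'
    have hy := Int.emod_nonneg (env y) hp0.ne'
    refine ⟨((env x % p).toNat, (env y % p).toNat), ⟨?_, ?_, ?_⟩, ?_, ?_⟩
    · simpa [Int.toNat_lt hx] using Int.emod_lt_of_pos _ hp0
    · simpa [Int.toNat_lt hy] using Int.emod_lt_of_pos _ hp0
    · simpa [Int.toNat_of_nonneg hx, Int.toNat_of_nonneg hy] using h
    · simp [Int.toNat_of_nonneg hx]
    · simp [Int.toNat_of_nonneg hy]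

theorem of_add_mem_of_two_le {p : ℕ} (hp : 2 ≤ p) (h : ∀ d ∈ D, d + p ∈ D) : DiffDfn D := by
  have hp0 : (0 : ℤ) < p := by omega
  have hup : ∀ d ∈ D, ∀ e, d ≤ e → d % p = e % p → e ∈ D := by
    intro d hd e hde hmod
    obtain ⟨k, hk⟩ := (Int.ModEq.dvd hmod : (p : ℤ) ∣ e - d)
    have hk0 : 0 ≤ k := by
      by_contra! hk0
      nlinarith
    lift k to ℕ using hk0
    obtain rfl : e = d + p * k := by linarith
    clear hk hde hmod
    induction k with
    | zero => simpa using hd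
    | succ k ih =>
      have := h _ ih
      push_cast
      convert this using 1
      ring
  have hD : D = ⋃₀ ((fun r : ℤ => D ∩ {d | d % p = r}) '' Set.Ico 0 p) := by
    ext d
    simp only [Set.sUnion_image, Set.mem_iUnion, Set.mem_inter_iff, Set.mem_ofPred_eq]
    exact ⟨fun hd => ⟨d % p, ⟨Int.emod_nonneg _ hp0.ne', Int.emod_lt_of_pos _ hp0⟩, hd, rfl⟩,
      fun ⟨_, _, hd, _⟩ => hd⟩
  rw [hD]
  refine sUnion ((Set.finite_Ico _ _).image _) ?_
  rintro _ ⟨r, -, rfl⟩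
  by_cases hb : ∃ b : ℤ, ∀ d, d ∈ D ∧ d % p = r → b ≤ d
  · by_cases hne : ∃ d, d ∈ D ∧ d % p = r
    · obtain ⟨m, ⟨hm, hmr⟩, hmin⟩ := Int.exists_least_of_bdd hb hne
      convert (Ici m).inter (emod_eq hp r) using 1
      ext d
      constructor
      · rintro ⟨h1, h2⟩
        exact ⟨hmin d ⟨h1, h2⟩, h2⟩
      · rintro ⟨h1, h2⟩
        exact ⟨hup m hm d h1 (hmr.trans h2.symm), h2⟩
    · have : D ∩ {d | d % p = r} = ∅ := by
        ext d
        simpa using fun h1 h2 => hne ⟨d, h1, h2⟩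
      intro x y
      simpa [this] using Dfn.const False
  · convert emod_eq hp r using 1
    ext d
    refine ⟨fun h => h.2, fun hd => ⟨?_, hd⟩⟩
    push Not at hb
    obtain ⟨e, ⟨he, her⟩, hed⟩ := hb d
    exact hup e he d hed.le (her.trans hd.symm)

theorem of_add_mem {p : ℤ} (hp : 0 < p) (h : ∀ d ∈ D, d + p ∈ D) : DiffDfn D := by
  lift p to ℕ using hp.le
  refine of_add_mem_of_two_le (p := p + p) (by omega) fun d hd => ?_
  have := h _ (h d hd)
  push_cast
  rwa [← add_assoc]

theorem of_isLinearSet (hD : IsLinearSet D) : DiffDfn D := by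
  obtain ⟨a, t, -, rfl⟩ := hD
  have hadd : ∀ p ∈ t, ∀ d ∈ a +ᵥ (AddSubmonoid.closure t : Set ℤ),
      d + p ∈ a +ᵥ (AddSubmonoid.closure t : Set ℤ) := by
    rintro p hp _ ⟨c, hc, rfl⟩
    refine ⟨c + p, add_mem hc (AddSubmonoid.subset_closure hp), ?_⟩
    simp [add_assoc]
  by_cases hpos : ∃ p ∈ t, 0 < p
  · obtain ⟨p, hpt, hp⟩ := hpos
    exact of_add_mem hp (hadd p hpt)
  by_cases hneg : ∃ p ∈ t, p < 0
  · obtain ⟨p, hpt, hp⟩ := hneg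
    refine neg (of_add_mem (p := -p) (by omega) fun d hd => ?_)
    rw [Set.mem_neg] at hd ⊢
    simpa [add_comm] using hadd p hpt _ hd
  · have ht : t ⊆ {0} := fun p hp => by
      by_contra h
      rcases lt_or_gt_of_ne h with h | h
      · exact hneg ⟨p, hp, h⟩
      · exact hpos ⟨p, hp, h⟩
    have : AddSubmonoid.closure t = ⊥ := by
      rw [eq_bot_iff, AddSubmonoid.closure_le]
      exact ht
    simpa [this] using singleton a

theorem of_isSemilinearSet (hD : IsSemilinearSet D) : DiffDfn D := by
  obtain ⟨S, hS, h, rfl⟩ := hD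
  exact sUnion hS fun t ht => of_isLinearSet (h t ht)

end DiffDfn

/-! ## The implication graph of a Krom ontology -/

/-- The complementary literal. -/
def Lit.compl (L : Lit) : Lit := (L.1, !L.2)

/-- The literal `L` is true in `M` at `n`. -/
def Lit.TrueAt (M : Itp) (L : Lit) (n : ℤ) : Prop := n ∈ M L.1 ↔ L.2 = true

@[simp] theorem Lit.compl_compl (L : Lit) : L.compl.compl = L := by simp [Lit.compl]

theorem Lit.trueAt_compl {M : Itp} {L : Lit} {n : ℤ} :
    L.compl.TrueAt M n ↔ ¬ L.TrueAt M n := by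
  rcases L with ⟨b, _ | _⟩ <;> simp [Lit.compl, Lit.TrueAt]

/-- The atom and the shift of a basic temporal concept built from ○F and ○P. -/
def TC.shiftForm : TC → ℕ × ℤ
  | .atom b => (b, 0)
  | .nextF C => (C.shiftForm.1, C.shiftForm.2 + 1)
  | .nextP C => (C.shiftForm.1, C.shiftForm.2 - 1)
  | _ => (0, 0)

theorem TC.IsBasicNext.mem_sem {C : TC} (hC : C.IsBasicNext) (M : Itp) (n : ℤ) :
    n ∈ C.sem M ↔ n + C.shiftForm.2 ∈ M C.shiftForm.1 := by
  induction hC generalizing n with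
  | atom b => simp [TC.sem, TC.shiftForm]
  | nextF _ ih =>
    simp only [TC.sem, TC.shiftForm, Set.mem_ofPred_eq, ih]
    ring_nf
  | nextP _ ih =>
    simp only [TC.sem, TC.shiftForm, Set.mem_ofPred_eq, ih]
    ring_nf

/-- The shifted literals of which the clause is the disjunction. -/
def Clause.lits (cl : Clause) : List (Lit × ℤ) :=
  cl.prem.map (fun C => ((C.shiftForm.1, false), C.shiftForm.2)) ++
    cl.concl.map (fun C => ((C.shiftForm.1, true), C.shiftForm.2))

theorem Clause.holds_iff_lits {cl : Clause} (hcl : cl.AllBasicNext) (M : Itp) :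
    cl.holds M ↔ ∀ n : ℤ, ∃ l ∈ cl.lits, l.1.TrueAt M (n + l.2) := by
  refine forall_congr' fun n => ?_
  have h1 : (∀ C ∈ cl.prem, n ∈ C.sem M) ↔
      ∀ C ∈ cl.prem, n + C.shiftForm.2 ∈ M C.shiftForm.1 :=
    forall₂_congr fun C hC => (hcl.1 C hC).mem_sem M n
  have h2 : (∃ C ∈ cl.concl, n ∈ C.sem M) ↔
      ∃ C ∈ cl.concl, n + C.shiftForm.2 ∈ M C.shiftForm.1 :=
    exists_congr fun C => and_congr_right fun hC => (hcl.2 C hC).mem_sem M n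
  rw [h1, h2, imp_iff_not_or]
  push Not
  simp only [Clause.lits, List.mem_append, List.mem_map, or_and_right, exists_or]
  refine or_congr ?_ ?_
  · constructor
    · rintro ⟨C, hC, h⟩
      exact ⟨_, ⟨C, hC, rfl⟩, by simpa [Lit.TrueAt] using h⟩
    · rintro ⟨_, ⟨C, hC, rfl⟩, h⟩
      exact ⟨C, hC, by simpa [Lit.TrueAt] using h⟩
  · constructor
    · rintro ⟨C, hC, h⟩
      exact ⟨_, ⟨C, hC, rfl⟩, by simpa [Lit.TrueAt] using h⟩
    · rintro ⟨_, ⟨C, hC, rfl⟩, h⟩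
      exact ⟨C, hC, by simpa [Lit.TrueAt] using h⟩

namespace Ontology

/-- The atomic concepts of the clauses of an ontology. -/
def litAtoms (O : Ontology) : Set ℕ := {b | ∃ cl ∈ O, ∃ l ∈ cl.lits, l.1.1 = b}

/-- The edges of the implication graph: `O.Edge L w L'` if a clause of `O` states that `L` at `n`
implies `L'` at `n + w`. -/
def Edge (O : Ontology) (L : Lit) (w : ℤ) (L' : Lit) : Prop :=
  ∃ cl ∈ O, ∃ l₁ ∈ cl.lits, ∃ l₂ ∈ cl.lits, (∀ l ∈ cl.lits, l = l₁ ∨ l = l₂) ∧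
    L = l₁.1.compl ∧ L' = l₂.1 ∧ w = l₂.2 - l₁.2

/-- The edges of the implication graph together with the trivial loops. -/
def ReflEdge (O : Ontology) (L : Lit) (w : ℤ) (L' : Lit) : Prop :=
  (L' = L ∧ w = 0) ∨ O.Edge L w L'

/-- Reachability in the implication graph. -/
def Reach (O : Ontology) : Lit → ℤ → Lit → Prop :=
  Walk O.ReflEdge {L | L.1 ∈ O.litAtoms}

variable {O : Ontology}

theorem finite_litAtoms : O.litAtoms.Finite := by
  refine (O.flatMap fun cl => cl.lits.map fun l => l.1.1).finite_toSet.subset ?_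
  rintro b ⟨cl, hcl, l, hl, rfl⟩
  simp only [Set.mem_ofPred_eq, List.mem_flatMap, List.mem_map]
  exact ⟨cl, hcl, l, hl, rfl⟩

theorem isSemilinearSet_reach (L L' : Lit) : IsSemilinearSet {w | O.Reach L w L'} := by
  refine Walk.isSemilinearSet ?_ (fun L L' => ?_) L L'
  · exact (finite_litAtoms.prod Set.finite_univ).subset fun L hL => ⟨hL, trivial⟩
  · have hfin : {l | l ∈ O.flatMap Clause.lits}.Finite := List.finite_toSet _
    refine ((Set.finite_singleton 0).union
      ((hfin.prod hfin).image fun l => l.2.2 - l.1.2)).subset ?_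
    rintro w (⟨-, rfl⟩ | ⟨cl, hcl, l₁, h₁, l₂, h₂, -, -, -, rfl⟩)
    · exact Or.inl rfl
    · exact Or.inr ⟨(l₁, l₂), ⟨List.mem_flatMap.2 ⟨cl, hcl, h₁⟩,
        List.mem_flatMap.2 ⟨cl, hcl, h₂⟩⟩, rfl⟩

theorem Edge.source_mem {L L' : Lit} {w : ℤ} (h : O.Edge L w L') : L.1 ∈ O.litAtoms := by
  obtain ⟨cl, hcl, l₁, h₁, -, -, -, rfl, -⟩ := h
  exact ⟨cl, hcl, l₁, h₁, rfl⟩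

theorem Edge.contrapose {L L' : Lit} {w : ℤ} (h : O.Edge L w L') :
    O.Edge L'.compl (-w) L.compl := by
  obtain ⟨cl, hcl, l₁, h₁, l₂, h₂, h, rfl, rfl, rfl⟩ := h
  exact ⟨cl, hcl, l₂, h₂, l₁, h₁, fun l hl => (h l hl).symm, rfl, Lit.compl_compl _, by ring⟩

theorem Edge.target_mem {L L' : Lit} {w : ℤ} (h : O.Edge L w L') : L'.1 ∈ O.litAtoms :=
  h.contrapose.source_mem

namespace Reach

theorem refl (L : Lit) : O.Reach L 0 L := .edge (Or.inl ⟨rfl, rfl⟩)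

theorem of_edge {L L' : Lit} {w : ℤ} (h : O.Edge L w L') : O.Reach L w L' := .edge (Or.inr h)

theorem tail {L L' L'' : Lit} {w w' : ℤ} (h : O.Reach L w L') (h' : O.ReflEdge L' w' L'') :
    O.Reach L (w + w') L'' := by
  obtain ⟨rfl, rfl⟩ | he := h'
  · simpa using h
  · exact .step h he.source_mem (Or.inr he)

theorem trans {L L' L'' : Lit} {w w' : ℤ} (h : O.Reach L w L') (h' : O.Reach L' w' L'') :
    O.Reach L (w + w') L'' := by
  induction h' with
  | edge he => exact h.tail he
  | step _ _ he ih => rw [← add_assoc]; exact ih.tail he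

theorem contrapose {L L' : Lit} {w : ℤ} (h : O.Reach L w L') :
    O.Reach L'.compl (-w) L.compl := by
  have hstep : ∀ {L L' : Lit} {w : ℤ}, O.ReflEdge L w L' → O.Reach L'.compl (-w) L.compl := by
    rintro L L' w (⟨rfl, rfl⟩ | he)
    · simpa using refl _
    · exact of_edge he.contrapose
  induction h with
  | edge he => exact hstep he
  | step _ _ he ih => rw [neg_add_rev]; exact (hstep he).trans ih

theorem target_mem {L L' : Lit} {w : ℤ} (h : O.Reach L w L') (hne : L' ≠ L) :
    L'.1 ∈ O.litAtoms := by
  induction h with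
  | edge he =>
    obtain ⟨rfl, -⟩ | he := he
    · exact (hne rfl).elim
    · exact he.target_mem
  | step _ hv he ih =>
    obtain ⟨rfl, -⟩ | he := he
    · exact hv
    · exact he.target_mem

theorem trueAt (hO : ∀ cl ∈ O, cl.AllBasicNext) {M : Itp} (hM : ∀ cl ∈ O, cl.holds M)
    {L L' : Lit} {w n : ℤ} (h : O.Reach L w L') (hL : L.TrueAt M n) : L'.TrueAt M (n + w) := by
  have hstep : ∀ {L L' : Lit} {w n : ℤ}, O.ReflEdge L w L' → L.TrueAt M n →
      L'.TrueAt M (n + w) := by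
    rintro L L' w n (⟨rfl, rfl⟩ | ⟨cl, hcl, l₁, h₁, l₂, h₂, h, rfl, rfl, rfl⟩) hL
    · simpa using hL
    · obtain ⟨l, hl, hlM⟩ := (Clause.holds_iff_lits (hO cl hcl) M).1 (hM cl hcl) (n - l₁.2)
      obtain rfl | rfl := h l hl
      · rw [sub_add_cancel] at hlM
        exact (Lit.trueAt_compl.1 hL hlM).elim
      · convert hlM using 1
        ring
  induction h with
  | edge he => exact hstep he hL
  | step _ _ he ih => rw [← add_assoc]; exact hstep he ih

end Reach

/-- An interpretation closed under the implication graph of a consistent Krom ontology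
is a model of it. -/
theorem KromNext.holds_of_edge (hO : O.KromNext) (hcons : O.Consistent) {M : Itp}
    (hM : ∀ (L : Lit) (w : ℤ) (L' : Lit) (n : ℤ),
      O.Edge L w L' → L.TrueAt M n → L'.TrueAt M (n + w)) :
    ∀ cl ∈ O, cl.holds M := by
  intro cl hcl
  rw [Clause.holds_iff_lits (hO cl hcl).1]
  intro n
  have key : ∃ l₁ ∈ cl.lits, ∃ l₂ ∈ cl.lits, ∀ l ∈ cl.lits, l = l₁ ∨ l = l₂ := by
    have hlen : cl.lits.length ≤ 2 := by
      simpa [Clause.lits] using show cl.prem.length + cl.concl.length ≤ 2 from (hO cl hcl).2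
    obtain ⟨M₀, hM₀⟩ := hcons
    obtain ⟨l, hl, -⟩ := (Clause.holds_iff_lits (hO cl hcl).1 M₀).1 (hM₀ cl hcl) 0
    match hlits : cl.lits, hlen, hl with
    | [l₁], _, _ => exact ⟨l₁, by simp, l₁, by simp, by simp⟩
    | [l₁, l₂], _, _ => exact ⟨l₁, by simp, l₂, by simp, by simp⟩
  obtain ⟨l₁, h₁, l₂, h₂, h⟩ := key
  by_cases hl₁ : l₁.1.TrueAt M (n + l₁.2)
  · exact ⟨l₁, h₁, hl₁⟩
  · refine ⟨l₂, h₂, ?_⟩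
    convert hM _ _ _ _ ⟨cl, hcl, l₁, h₁, l₂, h₂, h, rfl, rfl, rfl⟩ (Lit.trueAt_compl.2 hl₁)
      using 1
    ring

/-- A set `U` of timestamped literals is satisfied in some model of a consistent Krom ontology
unless the implication graph leads from a member of `U` to the complement of one. -/
theorem KromNext.exists_model (hO : O.KromNext) (hcons : O.Consistent) (U : Lit → ℤ → Prop)
    (hU : ∀ L n L' n', U L n → U L' n' → ¬ O.Reach L (n' - n) L'.compl) :
    ∃ M : Itp, (∀ cl ∈ O, cl.holds M) ∧ ∀ L n, U L n → L.TrueAt M n := by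
  obtain ⟨M₀, hM₀⟩ := id hcons
  let R : Lit → ℤ → Prop := fun L n => ∃ L₀ n₀, U L₀ n₀ ∧ O.Reach L₀ (n - n₀) L
  have hR : ∀ L n, R L n → ¬ R L.compl n := by
    rintro L n ⟨L₁, n₁, hU₁, h₁⟩ ⟨L₂, n₂, hU₂, h₂⟩
    refine hU L₁ n₁ L₂ n₂ hU₁ hU₂ ?_
    convert h₁.trans (by simpa using h₂.contrapose) using 1
    ring
  have hRstep : ∀ {L L' : Lit} {w n : ℤ}, O.Edge L w L' → R L n → R L' (n + w) := by
    rintro L L' w n he ⟨L₀, n₀, hU₀, h₀⟩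
    refine ⟨L₀, n₀, hU₀, ?_⟩
    convert h₀.trans (.of_edge he) using 1
    ring
  let M : Itp := fun b => {n | R (b, true) n ∨ (n ∈ M₀ b ∧ ¬ R (b, false) n)}
  have hMiff : ∀ L n, Lit.TrueAt M L n ↔ R L n ∨ (L.TrueAt M₀ n ∧ ¬ R L.compl n) := by
    rintro ⟨b, _ | _⟩ n
    · have := hR (b, true) n
      simp only [Lit.TrueAt, Lit.compl, M, Set.mem_ofPred_eq, Bool.not_false, Bool.not_true,
        Bool.false_eq_true, iff_false] at this ⊢
      generalize R (b, true) n = P at this ⊢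
      generalize R (b, false) n = Q at this ⊢
      tauto
    · simp only [Lit.TrueAt, Lit.compl, M, Set.mem_ofPred_eq, Bool.not_true, iff_true]
  refine ⟨M, hO.holds_of_edge hcons fun L w L' n he hL => ?_, fun L n hUL => ?_⟩
  · rw [hMiff] at hL ⊢
    rcases hL with hL | ⟨hL, hL'⟩
    · exact Or.inl (hRstep he hL)
    · refine Or.inr ⟨(Reach.of_edge he).trueAt (fun cl hcl => (hO cl hcl).1) hM₀ hL,
        fun h => hL' ?_⟩
      simpa using hRstep he.contrapose h
  · exact (hMiff L n).2 (Or.inl ⟨L, n, hUL, by simpa using Reach.refl L⟩)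

end Ontology

theorem DataInstance.minT_eq_zero (A : DataInstance) : A.minT = 0 := by
  obtain ⟨p, hp, hp0⟩ := A.has_zero
  refine le_antisymm ?_ ?_
  · rw [← hp0]
    exact Finset.min'_le _ _ (Finset.mem_image_of_mem _ hp)
  · refine Finset.le_min' _ _ _ fun n hn => ?_
    obtain ⟨q, hq, rfl⟩ := Finset.mem_image.1 hn
    exact A.nonneg q hq

theorem DataInstance.tem_eq (A : DataInstance) : A.tem = Set.Icc 0 A.maxT := by
  rw [DataInstance.tem, A.minT_eq_zero]

theorem DataInstance.mem_tem (A : DataInstance) {p : ℕ × ℤ} (hp : p ∈ A.atoms) :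
    p.2 ∈ A.tem :=
  ⟨Finset.min'_le _ _ (Finset.mem_image_of_mem _ hp),
    Finset.le_max' _ _ (Finset.mem_image_of_mem _ hp)⟩

/-- Entailment of an atom by a consistent Krom ontology and a data instance, in terms of
reachability in the implication graph. -/
theorem Ontology.KromNext.entails_iff {O : Ontology} (hO : O.KromNext) (hcons : O.Consistent)
    (a : ℕ) (A : DataInstance) (n : ℤ) :
    (∀ M : Itp, IsModel M O A → n ∈ M a) ↔
      O.Reach (a, false) 0 (a, true) ∨
      (∃ b ∈ insert a O.litAtoms, ∃ d ∈ Set.Icc 0 A.maxT, d ∈ A.itp b ∧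
        O.Reach (a, false) (d - n) (b, false)) ∨
      (∃ b ∈ O.litAtoms, ∃ c ∈ O.litAtoms, ∃ d ∈ Set.Icc 0 A.maxT, ∃ e ∈ Set.Icc 0 A.maxT,
        d ∈ A.itp b ∧ e ∈ A.itp c ∧ O.Reach (b, true) (e - d) (c, false)) := by
  have hbasic : ∀ cl ∈ O, cl.AllBasicNext := fun cl hcl => (hO cl hcl).1
  constructor
  · intro h
    by_contra hnot
    push Not at hnot
    obtain ⟨h1, h2, h3⟩ := hnot
    have htem : ∀ {b d}, (b, d) ∈ A.atoms → d ∈ Set.Icc 0 A.maxT := fun hb =>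
      A.tem_eq ▸ A.mem_tem hb
    have h2' : ∀ {b d}, (b, d) ∈ A.atoms → ¬ O.Reach (a, false) (d - n) (b, false) := by
      intro b d hb hr
      refine h2 b ?_ d (htem hb) hb hr
      by_cases hba : b = a
      · exact Or.inl hba
      · exact Or.inr (hr.target_mem (by simpa using hba))
    obtain ⟨M, hM, hMU⟩ := hO.exists_model hcons
      (fun L m => (L = (a, false) ∧ m = n) ∨ (L.2 = true ∧ (L.1, m) ∈ A.atoms)) (by
        rintro L m ⟨c, s⟩ m' (⟨rfl, rfl⟩ | ⟨hL, hLA⟩) (⟨hc, rfl⟩ | ⟨hs, hcA⟩) hr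
        · obtain ⟨rfl, rfl⟩ := Prod.mk.inj hc
          exact h1 (by simpa [Lit.compl] using hr)
        · simp only at hs hcA
          subst hs
          exact h2' hcA hr
        · obtain ⟨rfl, rfl⟩ := Prod.mk.inj hc
          obtain ⟨b, t⟩ := L
          simp only at hL hLA
          subst hL
          refine h2' hLA ?_
          simpa [Lit.compl] using hr.contrapose
        · obtain ⟨b, t⟩ := L
          simp only at hs hcA hL hLA
          subst hs hL
          refine h3 b ?_ c ?_ m (htem hLA) m' (htem hcA) hLA hcA hr
          · simpa [Lit.compl] using hr.contrapose.target_mem (by simp [Lit.compl])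
          · simpa [Lit.compl] using hr.target_mem (by simp [Lit.compl]))
    have hna := hMU (a, false) n (Or.inl ⟨rfl, rfl⟩)
    simp only [Lit.TrueAt, Bool.false_eq_true, iff_false] at hna
    refine hna (h M ⟨hM, fun p hp => ?_⟩)
    simpa [Lit.TrueAt] using hMU (p.1, true) p.2 (Or.inr ⟨rfl, hp⟩)
  · rintro h M ⟨hM, hA⟩
    by_contra hna
    have hna' : Lit.TrueAt M (a, false) n := by simpa [Lit.TrueAt] using hna
    rcases h with h | ⟨b, -, d, -, hd, h⟩ | ⟨b, -, c, -, d, -, e, -, hd, he, h⟩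
    · have := h.trueAt hbasic hM hna'
      simp [Lit.TrueAt, hna] at this
    · have := h.trueAt hbasic hM hna'
      have hb : d ∈ M b := hA _ hd
      simp [Lit.TrueAt, hb] at this
    · have hb : d ∈ M b := hA _ hd
      have hc : e ∈ M c := hA _ he
      have := h.trueAt (n := d) hbasic hM (by simpa [Lit.TrueAt] using hb)
      simp [Lit.TrueAt, hc] at this

/-- FO(<,≡)-rewritability of LTL_krom^○ OMAQs. -/
theorem kromNext_OMAQ_FOltMod_rewritable (O : Ontology) (hO : O.KromNext) (a : ℕ) :
    ∃ φ : Fml, φ.IsFOltMod ∧ φ.fvars ⊆ {0} ∧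
      ∀ A : DataInstance,
        certAns O (.atom a) A = {ℓ ∈ A.tem | Fml.evalIn A.tem A.itp φ (fun _ => ℓ)} := by
  by_cases hcons : O.Consistent
  · have hreach : ∀ (L L' : Lit), DiffDfn {w | O.Reach L w L'} := fun L L' =>
      .of_isSemilinearSet (Ontology.isSemilinearSet_reach L L')
    have hfin := O.finite_litAtoms
    have hone : Dfn {0} fun T I env => ∃ b ∈ insert a O.litAtoms, ∃ d ∈ Set.Icc 0 T,
        d ∈ I b ∧ O.Reach (a, false) (d - env 0) (b, false) :=
      Dfn.exists_mem (hfin.insert a) fun b _ => by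
        have h := (((Dfn.atom b 1).mono (G := {0, 1}) (by simp)).and
          (hreach (a, false) (b, false) 0 1)).ex 1
        exact (h.mono (by grind)).congr (by simp)
    have htwo : Dfn {0} fun T I _ => ∃ b ∈ O.litAtoms, ∃ c ∈ O.litAtoms,
        ∃ d ∈ Set.Icc 0 T, ∃ e ∈ Set.Icc 0 T,
          d ∈ I b ∧ e ∈ I c ∧ O.Reach (b, true) (e - d) (c, false) :=
      Dfn.exists_mem hfin fun b _ => Dfn.exists_mem hfin fun c _ => by
        have h := ((((Dfn.atom b 1).mono (G := {1, 2}) (by simp)).and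
          (((Dfn.atom c 2).mono (by simp)).and (hreach (b, true) (c, false) 1 2))).ex 2).ex 1
        exact (h.mono (by grind)).congr (by simp)
    obtain ⟨φ, h1, h2, h3⟩ :=
      (Dfn.const (O.Reach (a, false) 0 (a, true))).or (hone.or htwo)
    refine ⟨φ, h1, h2, fun A => Set.ext fun ℓ => and_congr_right fun hℓ => ?_⟩
    rw [A.tem_eq] at hℓ ⊢
    exact (hO.entails_iff hcons a A ℓ).trans
      (h3 A.maxT A.itp (fun _ => ℓ) (hℓ.1.trans hℓ.2) fun _ => hℓ).symm
  · refine ⟨.neg .falsum, trivial, Set.empty_subset _, fun A => Set.ext fun ℓ =>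
      and_congr_right fun _ => ?_⟩
    exact iff_of_true (fun M hM => (hcons ⟨M, hM.1⟩).elim) id

end LTLOMQ
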